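/- Let ⟨S | R⟩ and ⟨S' | R'⟩ be two finite presentations of the same group Γ (i.e., there is a group isomorphism F(S)/⟨⟨R⟩⟩ ≅ F(S')/⟨⟨R'⟩⟩), and let 𝒞 be a family of groups with bi-invariant metrics. Then Γ is 𝒞-stable with respect to the presentation ⟨S | R⟩ if and only if it is 𝒞-stable with respect to the presentation ⟨S' | R'⟩. -/

import Mathlib

/-- A group equipped with a bi-invariant metric. -/
structure MetricGroup where
  carrier : Type
  [group : Group carrier]
  [metric : MetricSpace carrier]
  dist_left_invariant : ∀ g x y : carrier, dist (g * x) (g * y) = dist x y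
  dist_right_invariant : ∀ g x y : carrier, dist (x * g) (y * g) = dist x y

attribute [instance] MetricGroup.group MetricGroup.metric

/-- defect(φ) = max_{r ∈ R} d(φ(r), 1), where φ also denotes the induced
homomorphism F(S) → G. -/
noncomputable def defect {S : Type} [Fintype S] (R : Finset (FreeGroup S)) {G : MetricGroup}
    (φ : S → G.carrier) : ℝ :=
  ((R.sup fun r => nndist ((FreeGroup.lift φ) r) 1 : NNReal) : ℝ)

/-- dist(φ, ψ) = max_{s ∈ S} d(φ(s), ψ(s)). -/
noncomputable def mapDist {S : Type} [Fintype S] {G : MetricGroup} (φ ψ : S → G.carrier) : ℝ :=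
  ((Finset.univ.sup fun s => nndist (φ s) (ψ s) : NNReal) : ℝ)

/-- HomDist(φ) = inf over homomorphisms π : Γ → G of dist(φ, (π ∘ q)|_S),
where Γ = F(S)/⟨⟨R⟩⟩ and q is the quotient map. -/
noncomputable def homDist {S : Type} [Fintype S] (R : Finset (FreeGroup S)) {G : MetricGroup}
    (φ : S → G.carrier) : ℝ :=
  ⨅ π : (FreeGroup S ⧸ Subgroup.normalClosure (R : Set (FreeGroup S))) →* G.carrier,
    mapDist φ (fun s => π ((QuotientGroup.mk' _) (FreeGroup.of s)))

/-- 𝒞-stability of the finitely presented group ⟨S | R⟩: for every ε > 0 there is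
δ > 0 such that any φ : S → G, G ∈ 𝒞, with defect(φ) < δ has HomDist(φ) < ε. -/
def Stable {S : Type} [Fintype S] (𝒞 : Set MetricGroup) (R : Finset (FreeGroup S)) : Prop :=
  ∀ ε : ℝ, 0 < ε → ∃ δ : ℝ, 0 < δ ∧ ∀ G ∈ 𝒞, ∀ φ : S → G.carrier,
    defect R φ < δ → homDist R φ < ε

theorem mg_mul {G : MetricGroup} (a b c d : G.carrier) :
    dist (a * b) (c * d) ≤ dist a c + dist b d := by
  calc dist (a * b) (c * d) ≤ dist (a * b) (c * b) + dist (c * b) (c * d) := dist_triangle _ _ _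
    _ = _ := by rw [G.dist_right_invariant, G.dist_left_invariant]

theorem mg_inv {G : MetricGroup} (a b : G.carrier) : dist a⁻¹ b⁻¹ = dist a b := by
  have h1 := G.dist_left_invariant a a⁻¹ b⁻¹
  have h2 := G.dist_right_invariant b (a * a⁻¹) (a * b⁻¹)
  rw [← h1, ← h2]
  simp [dist_comm]

theorem defect_nonneg {S : Type} [Fintype S] (R : Finset (FreeGroup S)) {G : MetricGroup}
    (φ : S → G.carrier) : 0 ≤ defect R φ := NNReal.coe_nonneg _

theorem mapDist_nonneg {S : Type} [Fintype S] {G : MetricGroup}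
    (φ ψ : S → G.carrier) : 0 ≤ mapDist φ ψ := NNReal.coe_nonneg _

theorem le_defect {S : Type} [Fintype S] (R : Finset (FreeGroup S)) {G : MetricGroup}
    (φ : S → G.carrier) {r : FreeGroup S} (hr : r ∈ R) :
    dist (FreeGroup.lift φ r) 1 ≤ defect R φ := by
  rw [← coe_nndist]
  exact NNReal.coe_le_coe.2 (Finset.le_sup (f := fun r => nndist ((FreeGroup.lift φ) r) 1) hr)

theorem defect_le {S : Type} [Fintype S] (R : Finset (FreeGroup S)) {G : MetricGroup}
    (φ : S → G.carrier) {c : ℝ} (hc : 0 ≤ c)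
    (h : ∀ r ∈ R, dist (FreeGroup.lift φ r) 1 ≤ c) : defect R φ ≤ c := by
  lift c to NNReal using hc
  refine NNReal.coe_le_coe.2 (Finset.sup_le fun r hr => ?_)
  exact NNReal.coe_le_coe.1 (by simpa using h r hr)

theorem le_mapDist {S : Type} [Fintype S] {G : MetricGroup}
    (φ ψ : S → G.carrier) (s : S) : dist (φ s) (ψ s) ≤ mapDist φ ψ := by
  rw [← coe_nndist]
  exact NNReal.coe_le_coe.2
    (Finset.le_sup (f := fun s => nndist (φ s) (ψ s)) (Finset.mem_univ s))

theorem mapDist_le {S : Type} [Fintype S] {G : MetricGroup}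
    (φ ψ : S → G.carrier) {c : ℝ} (hc : 0 ≤ c)
    (h : ∀ s, dist (φ s) (ψ s) ≤ c) : mapDist φ ψ ≤ c := by
  lift c to NNReal using hc
  refine NNReal.coe_le_coe.2 (Finset.sup_le fun r hr => ?_)
  exact NNReal.coe_le_coe.1 (by simpa using h r)

theorem defect_bound {S : Type} [Fintype S] (R : Finset (FreeGroup S)) (w : FreeGroup S)
    (hw : w ∈ Subgroup.normalClosure (R : Set (FreeGroup S))) :
    ∃ C : ℝ, 0 ≤ C ∧ ∀ (G : MetricGroup) (φ : S → G.carrier),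
      dist (FreeGroup.lift φ w) 1 ≤ C * defect R φ := by
  unfold Subgroup.normalClosure at hw
  induction hw using Subgroup.closure_induction with
  | mem x hx =>
    obtain ⟨r, hr, hc⟩ := Group.mem_conjugatesOfSet_iff.1 hx
    obtain ⟨c, rfl⟩ := isConj_iff.1 hc
    refine ⟨1, zero_le_one, fun G φ => ?_⟩
    have h := le_defect R φ (Finset.mem_coe.1 hr)
    rw [← G.dist_left_invariant (FreeGroup.lift φ c),
      ← G.dist_right_invariant (FreeGroup.lift φ c)⁻¹] at h
    simpa using h
  | one => exact ⟨0, le_rfl, fun G φ => by simp⟩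
  | mul x y _ _ hx hy =>
    obtain ⟨C, hC, h⟩ := hx
    obtain ⟨D, hD, k⟩ := hy
    refine ⟨C + D, add_nonneg hC hD, fun G φ => ?_⟩
    have := mg_mul (FreeGroup.lift φ x) (FreeGroup.lift φ y) 1 1
    rw [mul_one] at this
    rw [map_mul]
    linarith [h G φ, k G φ]
  | inv x _ hx =>
    obtain ⟨C, hC, h⟩ := hx
    refine ⟨C, hC, fun G φ => ?_⟩
    have := mg_inv (FreeGroup.lift φ x) 1
    rw [inv_one] at this
    rw [map_inv, this]
    exact h G φ

theorem word_bound {S : Type} [Fintype S] (w : FreeGroup S) :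
    ∃ C : ℝ, 0 ≤ C ∧ ∀ (G : MetricGroup) (φ ψ : S → G.carrier),
      dist (FreeGroup.lift φ w) (FreeGroup.lift ψ w) ≤ C * mapDist φ ψ := by
  induction w using FreeGroup.induction_on with
  | C1 => exact ⟨0, le_rfl, fun G φ ψ => by simp⟩
  | of s => exact ⟨1, zero_le_one, fun G φ ψ => by simpa using le_mapDist φ ψ s⟩
  | inv_of x hx =>
    obtain ⟨C, hC, h⟩ := hx
    refine ⟨C, hC, fun G φ ψ => ?_⟩
    rw [map_inv, map_inv, mg_inv]
    exact h G φ ψ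
  | mul x y hx hy =>
    obtain ⟨C, hC, h⟩ := hx
    obtain ⟨D, hD, k⟩ := hy
    refine ⟨C + D, add_nonneg hC hD, fun G φ ψ => ?_⟩
    rw [map_mul, map_mul]
    linarith [h G φ ψ, k G φ ψ,
      mg_mul (FreeGroup.lift φ x) (FreeGroup.lift φ y) (FreeGroup.lift ψ x) (FreeGroup.lift ψ y)]

theorem defect_bound_unif {ι S : Type} [Fintype S] (R : Finset (FreeGroup S)) (t : Finset ι)
    (w : ι → FreeGroup S)
    (hw : ∀ i, i ∈ t → w i ∈ Subgroup.normalClosure (R : Set (FreeGroup S))) :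
    ∃ C : ℝ, 0 ≤ C ∧ ∀ i ∈ t, ∀ (G : MetricGroup) (φ : S → G.carrier),
      dist (FreeGroup.lift φ (w i)) 1 ≤ C * defect R φ := by
  choose! C hC h using fun i hi => defect_bound R (w i) (hw i hi)
  refine ⟨∑ i ∈ t, C i, Finset.sum_nonneg hC, fun i hi G φ => (h i hi G φ).trans ?_⟩
  exact mul_le_mul_of_nonneg_right (Finset.single_le_sum hC hi) (defect_nonneg _ _)

theorem word_bound_unif {ι S : Type} [Fintype S] [Fintype ι] (w : ι → FreeGroup S) :
    ∃ C : ℝ, 0 ≤ C ∧ ∀ i, ∀ (G : MetricGroup) (φ ψ : S → G.carrier),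
      dist (FreeGroup.lift φ (w i)) (FreeGroup.lift ψ (w i)) ≤ C * mapDist φ ψ := by
  choose C hC h using fun i => word_bound (w i)
  refine ⟨∑ i, C i, Finset.sum_nonneg fun i _ => hC i, fun i G φ ψ => (h i G φ ψ).trans ?_⟩
  exact mul_le_mul_of_nonneg_right
    (Finset.single_le_sum (fun i _ => hC i) (Finset.mem_univ i)) (mapDist_nonneg _ _)

theorem stable_forward
    {S S' : Type} [Fintype S] [Fintype S']
    (R : Finset (FreeGroup S)) (R' : Finset (FreeGroup S'))
    (e : (FreeGroup S ⧸ Subgroup.normalClosure (R : Set (FreeGroup S))) ≃*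
         (FreeGroup S' ⧸ Subgroup.normalClosure (R' : Set (FreeGroup S'))))
    (𝒞 : Set MetricGroup) (H : Stable 𝒞 R) : Stable 𝒞 R' := by
  set q := QuotientGroup.mk' (Subgroup.normalClosure (R : Set (FreeGroup S))) with hq
  set q' := QuotientGroup.mk' (Subgroup.normalClosure (R' : Set (FreeGroup S'))) with hq'
  choose f hf using fun s : S => QuotientGroup.mk'_surjective _ (e (q (FreeGroup.of s)))
  choose g hg using fun s : S' => QuotientGroup.mk'_surjective _ (e.symm (q' (FreeGroup.of s)))
  have hF : ∀ w, q' (FreeGroup.lift f w) = e (q w) := by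
    intro w
    have : q'.comp (FreeGroup.lift f) = e.toMonoidHom.comp q := by
      ext s
      have := hf s
      simp only [MonoidHom.comp_apply, FreeGroup.lift_apply_of]
      exact this
    exact DFunLike.congr_fun this w
  have ker' : ∀ w, q' w = 1 → w ∈ Subgroup.normalClosure (R' : Set (FreeGroup S')) :=
    fun w hw => (QuotientGroup.eq_one_iff w).1 hw
  have kerR : ∀ r ∈ R, q r = 1 :=
    fun r hr => (QuotientGroup.eq_one_iff r).2 (Subgroup.subset_normalClosure hr)
  obtain ⟨C₁, hC₁, h₁⟩ := defect_bound_unif R' R (fun r => FreeGroup.lift f r)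
    (fun r hr => ker' _ (by rw [hF, kerR r hr, map_one]))
  obtain ⟨C₂, hC₂, h₂⟩ := defect_bound_unif R' Finset.univ
    (fun s => FreeGroup.of s * (FreeGroup.lift f (g s))⁻¹)
    (fun s _ => ker' _ (by
      have := hg s
      rw [map_mul, map_inv, hF, this, e.apply_symm_apply, mul_inv_cancel]))
  obtain ⟨K, hK, h₃⟩ := word_bound_unif g
  intro ε hε
  obtain ⟨δ, hδ, hst⟩ := H (ε / (2 * (K + 1))) (by positivity)
  refine ⟨min (δ / (C₁ + 1)) (ε / (2 * (C₂ + 1))), by positivity, fun G hG φ' hφ' => ?_⟩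
  have hd := defect_nonneg R' φ'
  have d1 := hφ'.trans_le (min_le_left _ _)
  have d2 := hφ'.trans_le (min_le_right _ _)
  rw [lt_div_iff₀ (by positivity)] at d1 d2
  let φ : S → G.carrier := fun s => FreeGroup.lift φ' (f s)
  have hφ : ∀ w, FreeGroup.lift φ w = FreeGroup.lift φ' (FreeGroup.lift f w) := by
    intro w
    have : FreeGroup.lift φ = (FreeGroup.lift φ').comp (FreeGroup.lift f) := by
      ext s
      simp [φ]
    exact DFunLike.congr_fun this w
  have hdef : defect R φ < δ := by
    refine (defect_le R φ (c := C₁ * defect R' φ') (by positivity) ?_).trans_lt (by linarith)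
    intro r hr
    rw [hφ]
    exact h₁ r hr G φ'
  obtain ⟨π, hπ⟩ := exists_lt_of_ciInf_lt (hst G hG φ hdef)
  rw [lt_div_iff₀ (by positivity)] at hπ
  set m := mapDist φ (fun s => π (q (FreeGroup.of s))) with hm
  have hm0 : 0 ≤ m := mapDist_nonneg _ _
  have hπq : ∀ w, FreeGroup.lift (fun s => π (q (FreeGroup.of s))) w = π (q w) := by
    intro w
    have : FreeGroup.lift (fun s => π (q (FreeGroup.of s))) = π.comp q := by
      ext s
      simp
    exact DFunLike.congr_fun this w
  refine (ciInf_le ⟨0, ?_⟩ (π.comp e.symm.toMonoidHom)).trans_lt ?_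
  · rintro _ ⟨ρ, rfl⟩
    exact mapDist_nonneg _ _
  refine (mapDist_le _ _ (c := C₂ * defect R' φ' + K * m) (by positivity) ?_).trans_lt
    (by linarith)
  intro s
  have e1 := h₂ s (Finset.mem_univ s) G φ'
  rw [← G.dist_right_invariant (FreeGroup.lift φ' (FreeGroup.lift f (g s)))] at e1
  simp only [map_mul, map_inv, inv_mul_cancel_right, one_mul, FreeGroup.lift_apply_of] at e1
  have e2 := h₃ s G φ (fun s => π (q (FreeGroup.of s)))
  have hg' : q (g s) = e.symm (q' (FreeGroup.of s)) := hg s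
  rw [hπq, hφ, hg'] at e2
  exact (dist_triangle _ _ _).trans (add_le_add e1 e2)

/-- Stability does not depend on the finite presentation: if
F(S)/⟨⟨R⟩⟩ ≅ F(S')/⟨⟨R'⟩⟩ then ⟨S | R⟩ is 𝒞-stable iff ⟨S' | R'⟩ is. -/
theorem stable_independent_of_presentation
    {S S' : Type} [Fintype S] [Fintype S']
    (R : Finset (FreeGroup S)) (R' : Finset (FreeGroup S'))
    (e : (FreeGroup S ⧸ Subgroup.normalClosure (R : Set (FreeGroup S))) ≃*
         (FreeGroup S' ⧸ Subgroup.normalClosure (R' : Set (FreeGroup S'))))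
    (𝒞 : Set MetricGroup) :
    Stable 𝒞 R ↔ Stable 𝒞 R' := by
  exact ⟨stable_forward R R' e 𝒞, stable_forward R' R e.symm 𝒞⟩
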